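/- Let X : [0,T] → ℝ^d be continuously differentiable with time-augmentation X̂, let I be a multi-index over the alphabet {0,1,…,d}, and let k ≥ 0. Then ⟨(e_I ⧢ e_0^{⊗k}) · e_0, S(X̂)_{0,T}⟩ = ∫_0^T S(X̂)^I_{0,u} · (u^k / k!) du, where e_0^{⊗k} is the word consisting of k copies of the time letter 0, ⧢ is the shuffle product, · e_0 denotes appending the letter 0 at the end of each word, and for a finite linear combination of words ℓ = Σ_K c_K e_K one sets ⟨ℓ, S(X̂)_{0,T}⟩ = Σ_K c_K S(X̂)^K_{0,T}. -/

import Mathlib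

open MeasureTheory

/-- The signature coefficient `S(X)^I_{s,t}` of a path `X : ℝ → ℝ^d` over `[s,t]`,
for a multi-index (word) `I = (i_1,…,i_n)`: the iterated integral
`∫_{s<u_1<⋯<u_n<t} X'_{i_1}(u_1)⋯X'_{i_n}(u_n) du`; for `I = ∅` it equals `1`. -/
noncomputable def sigCoeff {d : ℕ} (X : ℝ → Fin d → ℝ) (s t : ℝ) (I : List (Fin d)) : ℝ :=
  ∫ u in {u : Fin I.length → ℝ |
      (∀ a b : Fin I.length, a < b → u a < u b) ∧ ∀ a, u a ∈ Set.Ioo s t},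
    ∏ a : Fin I.length, deriv (fun r => X r (I.get a)) (u a)

/-- The time-augmented path `X̂_t = (t, X_t) ∈ ℝ^{1+d}`, with coordinate `0` being time. -/
noncomputable def timeAug {d : ℕ} (X : ℝ → Fin d → ℝ) : ℝ → Fin (d + 1) → ℝ :=
  fun t => Fin.cons t (X t)

/-- The shuffle product of two words, as the list (with multiplicity) of all their
shuffles, so that `e_I ⧢ e_J = Σ_{K ∈ shuffle I J} e_K`. -/
def shuffle {α : Type*} : List α → List α → List (List α)
  | [], J => [J]
  | a :: I, [] => [a :: I]
  | a :: I, b :: J =>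
      ((shuffle I (b :: J)).map (List.cons a)) ++ ((shuffle (a :: I) J).map (List.cons b))
termination_by I J => I.length + J.length

/-- The open simplex `s < u_1 < ⋯ < u_n < t`. -/
def openSimplex (n : ℕ) (s t : ℝ) : Set (Fin n → ℝ) :=
  {u | (∀ a b : Fin n, a < b → u a < u b) ∧ ∀ a, u a ∈ Set.Ioo s t}

theorem measurableSet_openSimplex (n : ℕ) (s t : ℝ) : MeasurableSet (openSimplex n s t) := by
  have h : openSimplex n s t =
      (⋂ a : Fin n, ⋂ b : Fin n, ⋂ _ : a < b, {u | u a < u b}) ∩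
        ⋂ a : Fin n, {u | u a ∈ Set.Ioo s t} := by
    ext u
    simp [openSimplex]
  rw [h]
  refine MeasurableSet.inter ?_ ?_
  · exact MeasurableSet.iInter fun a => MeasurableSet.iInter fun b => MeasurableSet.iInter fun _ =>
      measurableSet_lt (measurable_pi_apply a) (measurable_pi_apply b)
  · exact MeasurableSet.iInter fun a => measurable_pi_apply a measurableSet_Ioo

theorem Continuous.integrableOn_openSimplex {n : ℕ} {F : (Fin n → ℝ) → ℝ} (hF : Continuous F)
    (s t : ℝ) : IntegrableOn F (openSimplex n s t) := by
  refine (hF.continuousOn.integrableOn_compact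
    (isCompact_Icc (a := fun _ => s) (b := fun _ => t))).mono_set ?_
  exact fun u hu => ⟨fun a => (hu.2 a).1.le, fun a => (hu.2 a).2.le⟩

/-- Fubini for a set integral over `ℝ^(n+1)`, singling out the `p`-th coordinate. -/
theorem setIntegral_eq_integral_insertNth {n : ℕ} (p : Fin (n + 1)) {S : Set (Fin (n + 1) → ℝ)}
    (hS : MeasurableSet S) {F : (Fin (n + 1) → ℝ) → ℝ} (hF : IntegrableOn F S) :
    ∫ u in S, F u = ∫ x : ℝ, ∫ v in {v : Fin n → ℝ | p.insertNth (α := fun _ => ℝ) x v ∈ S},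
      F (p.insertNth (α := fun _ => ℝ) x v) := by
  have hmp := (volume_preserving_piFinSuccAbove (fun _ : Fin (n + 1) => ℝ) p).symm
  have hI : Integrable (S.indicator F) := (integrable_indicator_iff hS).2 hF
  rw [← integral_indicator hS, ← hmp.integral_comp', Measure.volume_eq_prod, integral_prod]
  · refine integral_congr_ae (Filter.Eventually.of_forall fun x => ?_)
    have hm : MeasurableSet {v : Fin n → ℝ | p.insertNth (α := fun _ => ℝ) x v ∈ S} :=
      ((MeasurableEquiv.piFinSuccAbove (fun _ : Fin (n + 1) => ℝ) p).symm.measurable.comp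
        measurable_prodMk_left) hS
    simp only
    rw [← integral_indicator hm]
    rfl
  · exact (hmp.integrable_comp_emb (MeasurableEquiv.measurableEmbedding _)).2 hI

/-- The iterated integral `∫_{s<u_1<⋯<u_n<t} g_1(u_1)⋯g_n(u_n) du`. -/
noncomputable def simplexIntegral {n : ℕ} (g : Fin n → ℝ → ℝ) (s t : ℝ) : ℝ :=
  ∫ u in openSimplex n s t, ∏ a, g a (u a)

theorem sigCoeff_eq_simplexIntegral {d : ℕ} (X : ℝ → Fin d → ℝ) (s t : ℝ) (I : List (Fin d)) :
    sigCoeff X s t I = simplexIntegral (fun a => deriv fun r => X r (I.get a)) s t := rfl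

theorem simplexIntegral_cast {m n : ℕ} (h : m = n) (g : Fin n → ℝ → ℝ) (s t : ℝ) :
    simplexIntegral (fun a => g (Fin.cast h a)) s t = simplexIntegral g s t := by
  subst h
  rfl

theorem simplexIntegral_zero (g : Fin 0 → ℝ → ℝ) (s t : ℝ) : simplexIntegral g s t = 1 := by
  have h : openSimplex 0 s t = Set.univ := by simp [openSimplex]
  simp [simplexIntegral, h, measureReal_def, volume_pi]

theorem cons_mem_openSimplex {n : ℕ} {s t x : ℝ} {v : Fin n → ℝ} :
    (Fin.cons x v : Fin (n + 1) → ℝ) ∈ openSimplex (n + 1) s t ↔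
      x ∈ Set.Ioo s t ∧ v ∈ openSimplex n x t := by
  simp only [openSimplex, Set.mem_ofPred_eq, Fin.forall_fin_succ, Fin.cons_zero, Fin.cons_succ,
    Fin.succ_lt_succ_iff, Fin.succ_pos, Set.mem_Ioo, Fin.not_lt_zero,
    false_imp_iff, true_imp_iff, true_and]
  constructor
  · rintro ⟨⟨h1, h2⟩, ⟨h3, h4⟩, h5⟩
    exact ⟨⟨h3, h4⟩, h2, fun a => ⟨h1 a, (h5 a).2⟩⟩
  · rintro ⟨⟨h3, h4⟩, h2, h5⟩
    exact ⟨⟨fun a => (h5 a).1, h2⟩, ⟨h3, h4⟩, fun a => ⟨h3.trans (h5 a).1, (h5 a).2⟩⟩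

theorem snoc_mem_openSimplex {n : ℕ} {s t x : ℝ} {v : Fin n → ℝ} :
    (Fin.snoc v x : Fin (n + 1) → ℝ) ∈ openSimplex (n + 1) s t ↔
      x ∈ Set.Ioo s t ∧ v ∈ openSimplex n s x := by
  simp only [openSimplex, Set.mem_ofPred_eq, Fin.forall_fin_succ', Fin.snoc_last, Fin.snoc_castSucc,
    Fin.castSucc_lt_castSucc_iff, Fin.castSucc_lt_last, Set.mem_Ioo,
    lt_irrefl, implies_true, false_imp_iff, true_imp_iff, and_true, (Fin.castSucc_lt_last _).not_gt]
  constructor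
  · rintro ⟨h1, h2, h3, h4⟩
    exact ⟨⟨h3, h4⟩, fun a b => (h1 a).1 b, fun a => ⟨(h2 a).1, (h1 a).2⟩⟩
  · rintro ⟨⟨h3, h4⟩, h2, h5⟩
    exact ⟨fun a => ⟨h2 a, (h5 a).2⟩, fun a => ⟨(h5 a).1, (h5 a).2.trans h4⟩, h3, h4⟩

theorem simplexIntegral_succ_left {n : ℕ} (g : Fin (n + 1) → ℝ → ℝ) (hg : ∀ a, Continuous (g a))
    {s t : ℝ} (hst : s ≤ t) :
    simplexIntegral g s t = ∫ x in s..t, g 0 x * simplexIntegral (fun a => g a.succ) x t := by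
  rw [simplexIntegral, setIntegral_eq_integral_insertNth 0 (measurableSet_openSimplex _ _ _)
    (Continuous.integrableOn_openSimplex (by fun_prop) s t), intervalIntegral.integral_of_le hst,
    integral_Ioc_eq_integral_Ioo, ← integral_indicator measurableSet_Ioo]
  refine integral_congr_ae (Filter.Eventually.of_forall fun x => ?_)
  simp only [Fin.insertNth_zero', cons_mem_openSimplex]
  by_cases hx : x ∈ Set.Ioo s t
  · simp [hx, simplexIntegral, Fin.prod_univ_succ, integral_const_mul]
  · simp [hx]

theorem simplexIntegral_succ_right {n : ℕ} (g : Fin (n + 1) → ℝ → ℝ) (hg : ∀ a, Continuous (g a))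
    {s t : ℝ} (hst : s ≤ t) :
    simplexIntegral g s t =
      ∫ x in s..t, simplexIntegral (fun a => g a.castSucc) s x * g (Fin.last n) x := by
  rw [simplexIntegral, setIntegral_eq_integral_insertNth (Fin.last n)
    (measurableSet_openSimplex _ _ _)
    (Continuous.integrableOn_openSimplex (by fun_prop) s t), intervalIntegral.integral_of_le hst,
    integral_Ioc_eq_integral_Ioo, ← integral_indicator measurableSet_Ioo]
  refine integral_congr_ae (Filter.Eventually.of_forall fun x => ?_)
  simp only [Fin.insertNth_last', snoc_mem_openSimplex]
  by_cases hx : x ∈ Set.Ioo s t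
  · simp [hx, simplexIntegral, Fin.prod_univ_castSucc, integral_mul_const]
  · simp [hx]

/-- The iterated integral of the word `I` over `[s, t]`, by recursion on the first letter. -/
noncomputable def wordIntegral {α : Type*} (f : α → ℝ → ℝ) (t : ℝ) : List α → ℝ → ℝ
  | [], _ => 1
  | a :: I, s => ∫ x in s..t, f a x * wordIntegral f t I x

section wordIntegral

variable {α : Type*} {f : α → ℝ → ℝ}

theorem continuous_wordIntegral (hf : ∀ a, Continuous (f a)) (I : List α) :
    Continuous fun p : ℝ × ℝ => wordIntegral f p.1 I p.2 := by
  induction I with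
  | nil => exact continuous_const
  | cons a I ih =>
    have hc : Continuous (Function.uncurry fun (p : ℝ × ℝ) (x : ℝ) =>
        f a x * wordIntegral f p.1 I x) :=
      ((hf a).comp continuous_snd).mul
        (ih.comp ((continuous_fst.comp continuous_fst).prodMk continuous_snd))
    have hi (p : ℝ × ℝ) (b c : ℝ) :
        IntervalIntegrable (fun x => f a x * wordIntegral f p.1 I x) volume b c :=
      (hc.comp (Continuous.prodMk_right p)).intervalIntegrable b c
    have h : (fun p : ℝ × ℝ => wordIntegral f p.1 (a :: I) p.2) = fun p =>
        (∫ x in (0 : ℝ)..p.1, f a x * wordIntegral f p.1 I x) -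
          ∫ x in (0 : ℝ)..p.2, f a x * wordIntegral f p.1 I x := by
      funext p
      rw [intervalIntegral.integral_interval_sub_left (hi _ _ _) (hi _ _ _)]
      rfl
    rw [h]
    exact (intervalIntegral.continuous_parametric_intervalIntegral_of_continuous hc
      continuous_fst).sub (intervalIntegral.continuous_parametric_intervalIntegral_of_continuous hc
      continuous_snd)

theorem continuous_wordIntegral_left (hf : ∀ a, Continuous (f a)) (t : ℝ) (I : List α) :
    Continuous (wordIntegral f t I) :=
  (continuous_wordIntegral hf I).comp (Continuous.prodMk_right t)

theorem hasDerivAt_wordIntegral_cons (hf : ∀ a, Continuous (f a)) (t : ℝ) (a : α) (I : List α)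
    (s : ℝ) :
    HasDerivAt (wordIntegral f t (a :: I)) (-(f a s * wordIntegral f t I s)) s := by
  have hc : Continuous fun x => f a x * wordIntegral f t I x :=
    (hf a).mul (continuous_wordIntegral_left hf t I)
  exact intervalIntegral.integral_hasDerivAt_left (hc.intervalIntegrable _ _)
    (hc.stronglyMeasurableAtFilter _ _) hc.continuousAt

theorem wordIntegral_cons_self (t : ℝ) (a : α) (I : List α) :
    wordIntegral f t (a :: I) t = 0 :=
  intervalIntegral.integral_same

theorem hasDerivAt_sum_wordIntegral_cons (hf : ∀ a, Continuous (f a)) (t : ℝ) (a : α)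
    (l : List (List α)) (s : ℝ) :
    HasDerivAt (fun s => ((l.map (List.cons a)).map fun K => wordIntegral f t K s).sum)
      (-(f a s * (l.map fun K => wordIntegral f t K s).sum)) s := by
  induction l with
  | nil => simpa using hasDerivAt_const s (0 : ℝ)
  | cons K l ih =>
    simp only [List.map_cons, List.sum_cons, mul_add, neg_add]
    exact (hasDerivAt_wordIntegral_cons hf t a K s).add ih

theorem sum_wordIntegral_cons_self (t : ℝ) (a : α) (l : List (List α)) :
    ((l.map (List.cons a)).map fun K => wordIntegral f t K t).sum = 0 := by
  induction l with
  | nil => simp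
  | cons K l ih => simp only [List.map_cons, List.sum_cons, wordIntegral_cons_self, ih, add_zero]

/-- The shuffle identity for iterated integrals. -/
theorem sum_shuffle_wordIntegral (hf : ∀ a, Continuous (f a)) (t : ℝ) (I J : List α) (s : ℝ) :
    ((shuffle I J).map fun K => wordIntegral f t K s).sum =
      wordIntegral f t I s * wordIntegral f t J s := by
  induction I, J using shuffle.induct generalizing s with
  | case1 J => simp [shuffle, wordIntegral]
  | case2 a I => simp [shuffle, wordIntegral]
  | case3 a I b J ih₁ ih₂ =>
    let D : ℝ → ℝ := fun s => ((shuffle (a :: I) (b :: J)).map fun K => wordIntegral f t K s).sum -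
      wordIntegral f t (a :: I) s * wordIntegral f t (b :: J) s
    have hD (s : ℝ) : HasDerivAt D 0 s := by
      have h := ((hasDerivAt_sum_wordIntegral_cons hf t a (shuffle I (b :: J)) s).add
        (hasDerivAt_sum_wordIntegral_cons hf t b (shuffle (a :: I) J) s)).sub
        ((hasDerivAt_wordIntegral_cons hf t a I s).mul (hasDerivAt_wordIntegral_cons hf t b J s))
      rw [ih₁, ih₂] at h
      refine (h.congr_deriv (by ring)).congr_of_eventuallyEq
        (Filter.Eventually.of_forall fun r => ?_)
      simp only [D, shuffle, List.map_append, List.sum_append, Pi.add_apply, Pi.sub_apply,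
        Pi.mul_apply]
    have h0 : D s = D t :=
      is_const_of_deriv_eq_zero (fun x => (hD x).differentiableAt) (fun x => (hD x).deriv) s t
    have h1 : D t = 0 := by
      simp only [D, shuffle, List.map_append, List.sum_append, sum_wordIntegral_cons_self,
        wordIntegral_cons_self, mul_zero, add_zero, sub_zero]
    exact sub_eq_zero.1 (h0.trans h1)

theorem wordIntegral_replicate {a : α} (ha : ∀ x, f a x = 1) (t : ℝ) (k : ℕ) (s : ℝ) :
    wordIntegral f t (List.replicate k a) s = (t - s) ^ k / (k.factorial : ℝ) := by
  induction k generalizing s with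
  | zero => simp [wordIntegral]
  | succ k ih =>
    rw [List.replicate_succ, wordIntegral]
    simp only [ha, one_mul, ih]
    rw [intervalIntegral.integral_div,
      intervalIntegral.integral_comp_sub_left (fun x => x ^ k) t, integral_pow, sub_self,
      Nat.factorial_succ]
    push_cast
    have : (k : ℝ) + 1 ≠ 0 := by positivity
    field_simp
    simp

end wordIntegral

theorem sigCoeff_eq_wordIntegral {d : ℕ} {X : ℝ → Fin d → ℝ}
    (hX : ∀ i, Continuous (deriv fun r => X r i)) (I : List (Fin d)) {s t : ℝ} (hst : s ≤ t) :
    sigCoeff X s t I = wordIntegral (fun i => deriv fun r => X r i) t I s := by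
  induction I generalizing s with
  | nil => exact simplexIntegral_zero _ s t
  | cons a I ih =>
    rw [sigCoeff_eq_simplexIntegral]
    refine (simplexIntegral_succ_left _ (fun _ => hX _) hst).trans ?_
    refine intervalIntegral.integral_congr fun x hx => ?_
    rw [Set.uIcc_of_le hst] at hx
    simp only [← ih hx.2]
    rfl

theorem sigCoeff_append_singleton {d : ℕ} {X : ℝ → Fin d → ℝ}
    (hX : ∀ i, Continuous (deriv fun r => X r i)) (I : List (Fin d)) (a : Fin d) {s t : ℝ}
    (hst : s ≤ t) :
    sigCoeff X s t (I ++ [a]) = ∫ u in s..t, sigCoeff X s u I * deriv (fun r => X r a) u := by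
  have hlen : I.length + 1 = (I ++ [a]).length := by simp
  rw [sigCoeff_eq_simplexIntegral, ← simplexIntegral_cast hlen,
    simplexIntegral_succ_right _ (fun _ => hX _) hst]
  simp [sigCoeff_eq_simplexIntegral]

theorem continuous_deriv_timeAug {d : ℕ} {X : ℝ → Fin d → ℝ} (hX : ContDiff ℝ 1 X)
    (i : Fin (d + 1)) : Continuous (deriv fun r => timeAug X r i) := by
  refine ContDiff.continuous_deriv (n := 1) ?_ le_rfl
  cases i using Fin.cases with
  | zero => exact contDiff_id
  | succ i => simpa [timeAug] using contDiff_pi.1 hX i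

theorem List.sum_map_intervalIntegral {β : Type*} (l : List β) {F : β → ℝ → ℝ} {a b : ℝ}
    (hF : ∀ K, IntervalIntegrable (F K) volume a b) :
    (l.map fun K => ∫ u in a..b, F K u).sum = ∫ u in a..b, (l.map fun K => F K u).sum := by
  have h : IntervalIntegrable (fun u => (l.map fun K => F K u).sum) volume a b ∧
      (l.map fun K => ∫ u in a..b, F K u).sum = ∫ u in a..b, (l.map fun K => F K u).sum := by
    induction l with
    | nil => simp
    | cons K l ih =>
      simp only [List.map_cons, List.sum_cons]
      exact ⟨(hF K).add ih.1, by rw [intervalIntegral.integral_add (hF K) ih.1, ih.2]⟩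
  exact h.2

/-- **Time-shuffle integration identity.** For a `C¹` path `X : [0,T] → ℝ^d` with
time-augmentation `X̂`, any word `I` over `{0,1,…,d}` and any `k ≥ 0`,
`⟨(e_I ⧢ e_0^{⊗k}) · e_0, S(X̂)_{0,T}⟩ = ∫_0^T S(X̂)^I_{0,u} · (u^k/k!) du`,
where `e_0^{⊗k}` is the word of `k` copies of the time letter `0` and `· e_0` appends the
time letter at the end of each word. -/
theorem shuffle_time_integration {d : ℕ} (T : ℝ) (hT : 0 ≤ T)
    (X : ℝ → Fin d → ℝ) (hX : ContDiff ℝ 1 X)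
    (I : List (Fin (d + 1))) (k : ℕ) :
    ((shuffle I (List.replicate k (0 : Fin (d + 1)))).map
        (fun K => sigCoeff (timeAug X) 0 T (K ++ [(0 : Fin (d + 1))]))).sum =
      ∫ u in (0:ℝ)..T, sigCoeff (timeAug X) 0 u I * (u ^ k / (Nat.factorial k : ℝ)) := by
  have hc := continuous_deriv_timeAug hX
  have h0 (u : ℝ) : deriv (fun r => timeAug X r 0) u = 1 := by simp [timeAug]
  let f : Fin (d + 1) → ℝ → ℝ := fun i => deriv fun r => timeAug X r i
  have key (K : List (Fin (d + 1))) : sigCoeff (timeAug X) 0 T (K ++ [0]) =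
      ∫ u in (0 : ℝ)..T, wordIntegral f u K 0 := by
    rw [sigCoeff_append_singleton hc K 0 hT]
    refine intervalIntegral.integral_congr fun u hu => ?_
    rw [Set.uIcc_of_le hT] at hu
    simp only [h0, mul_one, sigCoeff_eq_wordIntegral hc K hu.1, f]
  simp only [key]
  rw [List.sum_map_intervalIntegral (F := fun K u => wordIntegral f u K 0) _ fun K =>
    ((continuous_wordIntegral hc K).comp (Continuous.prodMk_left 0)).intervalIntegrable 0 T]
  refine intervalIntegral.integral_congr fun u hu => ?_
  rw [Set.uIcc_of_le hT] at hu
  simp only [sum_shuffle_wordIntegral (f := f) hc, wordIntegral_replicate (f := f) h0, sub_zero]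
  rw [sigCoeff_eq_wordIntegral hc I hu.1]
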